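/- If ∑_{k=1}^{n} w_k(B_k) < 1, then the collection 𝒜 does not cover Q; that is, there exists an element of Q lying on no hyperplane of 𝒜. -/

import Mathlib

open Finset
open scoped Classical

/-- A hyperplane in `S_1 × ⋯ × S_n`.  Coordinates are 0-indexed in Lean:
coordinate `j : ℕ`, `j < n`, corresponds to the paper's coordinate `j + 1`,
so the paper's set `S_j` is `S (j - 1)` here.  A hyperplane is recorded by its
finite set `F` of fixed coordinates together with the fixed value at each
fixed coordinate (on the non-fixed coordinates it is all of `S j`). -/
structure Hyp (S : ℕ → Type) (n : ℕ) where
  F : Finset ℕ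
  hF : ∀ j ∈ F, j < n
  val : ∀ j ∈ F, S j

/-- The stage of a hyperplane: in the paper's 1-based labelling,
`A.stage = max F(A)`; in the 0-based labelling it is `(sup of A.F) + 1`. -/
def Hyp.stage {S : ℕ → Type} {n : ℕ} (A : Hyp S n) : ℕ := A.F.sup id + 1

/-- `Qp S k` is the paper's `Q_k = S_1 × ⋯ × S_k` (in 0-based indexing,
`S 0 × ⋯ × S (k-1)`).  `Qp S 0` is a one-element type. -/
abbrev Qp (S : ℕ → Type) (k : ℕ) := ∀ j : Fin k, S j

/-- `x ∈ Q_k` lies on (the projection to `Q_k` of) the hyperplane `A`;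
this is the correct notion of membership whenever `F(A) ⊆ {1, …, k}`. -/
def memH {S : ℕ → Type} {n : ℕ} (A : Hyp S n) {k : ℕ} (x : Qp S k) : Prop :=
  ∀ (j : Fin k) (h : (j : ℕ) ∈ A.F), x j = A.val j h

/-- Membership in `B_k = ⋃_{A ∈ 𝒜_k} A`, viewed as a subset of `Q_k`, where
`𝒜_k = {A ∈ 𝒜 : max F(A) = k}` (1-based `k`). -/
def memB {S : ℕ → Type} {n : ℕ} {ι : Type} (𝓐 : ι → Hyp S n) (k : ℕ) (x : Qp S k) : Prop :=
  ∃ i, (𝓐 i).stage = k ∧ memH (𝓐 i) x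

/-- `alpha 𝓐 k x` is the paper's `α_{k+1}(x)` for `x ∈ Q_k`: the proportion of
the fiber `F_x` covered by `B_{k+1}`. -/
noncomputable def alpha {S : ℕ → Type} [∀ j, Fintype (S j)] {n : ℕ} {ι : Type}
    (𝓐 : ι → Hyp S n) (k : ℕ) (x : Qp S k) : ℝ :=
  ((univ.filter fun y : S k => memB 𝓐 (k + 1) (Fin.snoc x y)).card : ℝ) /
    (Fintype.card (S k))

/-- The weights `w_k : Q_k → ℝ`, defined inductively:  `w_0 ≡ 1`, and `w_(k+1)`
is obtained from `w_k` by the distortion rule with parameter `δ_{k+1} = δ k`.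
(The paper's `δ_j` is `δ (j - 1)` here.) -/
noncomputable def w {S : ℕ → Type} [∀ j, Fintype (S j)] {n : ℕ} {ι : Type}
    (𝓐 : ι → Hyp S n) (δ : ℕ → ℝ) : (k : ℕ) → Qp S k → ℝ
  | 0, _ => 1
  | (k + 1), x =>
      let x' : Qp S k := fun j => x j.castSucc
      let a : ℝ := alpha 𝓐 k x'
      if memB 𝓐 (k + 1) x then
        if a ≤ δ k then 0
        else ((a - δ k) / (a * (1 - δ k))) * (w 𝓐 δ k x' / (Fintype.card (S k)))
      else
        if a ≤ δ k then (1 / (1 - a)) * (w 𝓐 δ k x' / (Fintype.card (S k)))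
        else (1 / (1 - δ k)) * (w 𝓐 δ k x' / (Fintype.card (S k)))

/-- `w_k(B_k)` (1-based `k`). -/
noncomputable def wB {S : ℕ → Type} [∀ j, Fintype (S j)] {n : ℕ} {ι : Type}
    (𝓐 : ι → Hyp S n) (δ : ℕ → ℝ) (k : ℕ) : ℝ :=
  ∑ x ∈ univ.filter (memB 𝓐 k), w 𝓐 δ k x

/-- `w_k(A)`: the weight of the projection to `Q_k` of a hyperplane `A`
(meaningful when `F(A) ⊆ {1, …, k}`). -/
noncomputable def wH {S : ℕ → Type} [∀ j, Fintype (S j)] {n : ℕ} {ι : Type}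
    (𝓐 : ι → Hyp S n) (δ : ℕ → ℝ) (k : ℕ) (A : Hyp S n) : ℝ :=
  ∑ x ∈ univ.filter (fun x : Qp S k => memH A x), w 𝓐 δ k x

/-- `ν(J) = ∏_{j ∈ J} 1 / ((1 - δ_j)|S_j|)` (0-based `J`). -/
noncomputable def nu (S : ℕ → Type) [∀ j, Fintype (S j)] (δ : ℕ → ℝ) (J : Finset ℕ) : ℝ :=
  ∏ j ∈ J, 1 / ((1 - δ j) * (Fintype.card (S j)))

/-- `‖J‖ = ∏_{j ∈ J} |S_j|` (0-based `J`). -/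
noncomputable def normJ (S : ℕ → Type) [∀ j, Fintype (S j)] (J : Finset ℕ) : ℝ :=
  ∏ j ∈ J, (Fintype.card (S j) : ℝ)

/-- `Ew 𝓐 δ k` is the paper's `E_k = E_{(k+1)-1} = ∑_{x ∈ Q_k} α_{k+1}(x)² w_k(x)`. -/
noncomputable def Ew {S : ℕ → Type} [∀ j, Fintype (S j)] {n : ℕ} {ι : Type}
    (𝓐 : ι → Hyp S n) (δ : ℕ → ℝ) (k : ℕ) : ℝ :=
  ∑ x : Qp S k, (alpha 𝓐 k x) ^ 2 * w 𝓐 δ k x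

section Lemmas

variable {S : ℕ → Type} [∀ j, Fintype (S j)] {n : ℕ} {ι : Type}
  (𝓐 : ι → Hyp S n) (δ : ℕ → ℝ) {k : ℕ}

/-- Summing over `Q_{k+1}` fiber by fiber. -/
theorem sum_Qp_succ (f : Qp S (k + 1) → ℝ) :
    ∑ x, f x = ∑ x : Qp S k, ∑ y : S k, f (Fin.snoc (α := fun j => S j) x y) := by
  rw [← (Fin.snocEquiv fun j : Fin (k + 1) => S j).sum_comp f]
  exact Fintype.sum_prod_type_right _

theorem alpha_nonneg (x : Qp S k) : 0 ≤ alpha 𝓐 k x := by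
  unfold alpha
  positivity

theorem w_snoc (x : Qp S k) (y : S k) :
    w 𝓐 δ (k + 1) (Fin.snoc x y) =
      (if memB 𝓐 (k + 1) (Fin.snoc x y : Qp S (k + 1)) then
        if alpha 𝓐 k x ≤ δ k then 0
        else (alpha 𝓐 k x - δ k) / (alpha 𝓐 k x * (1 - δ k))
      else if alpha 𝓐 k x ≤ δ k then 1 / (1 - alpha 𝓐 k x) else 1 / (1 - δ k)) *
        (w 𝓐 δ k x / Fintype.card (S k)) := by
  have h : (fun j : Fin k => (Fin.snoc x y : Qp S (k + 1)) j.castSucc) = x :=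
    funext fun j => Fin.snoc_castSucc (α := fun j : Fin (k + 1) => S j) y x j
  simp only [w, h]
  split_ifs <;> simp

theorem w_nonneg (hδ : ∀ j < k, δ j ∈ Set.Ico (0 : ℝ) 1) (x : Qp S k) : 0 ≤ w 𝓐 δ k x := by
  induction k with
  | zero => exact zero_le_one
  | succ k ih =>
    rw [← Fin.snoc_init_self x]
    have hw := ih (fun j hj => hδ j (by omega)) (Fin.init x)
    obtain ⟨h0, h1⟩ := hδ k (by omega)
    refine (w_snoc 𝓐 δ (Fin.init x) (x (Fin.last k))).symm ▸
      mul_nonneg ?_ (div_nonneg hw (Nat.cast_nonneg _))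
    have ha : 0 ≤ alpha 𝓐 k (Fin.init x : Qp S k) := alpha_nonneg 𝓐 _
    split_ifs with _ h h
    · exact le_rfl
    · exact div_nonneg (by linarith) (mul_nonneg ha (by linarith))
    · exact div_nonneg zero_le_one (by linarith)
    · exact div_nonneg zero_le_one (by linarith)

/-- The distortion rule preserves the total weight of each fiber. -/
theorem sum_w_snoc (hδ : δ k ∈ Set.Ico (0 : ℝ) 1) (hS : 0 < Fintype.card (S k)) (x : Qp S k) :
    ∑ y : S k, w 𝓐 δ (k + 1) (Fin.snoc x y) = w 𝓐 δ k x := by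
  obtain ⟨h0, h1⟩ := hδ
  have hc : (0 : ℝ) < Fintype.card (S k) := Nat.cast_pos.2 hS
  simp only [w_snoc]
  rw [← Finset.sum_mul, Finset.sum_ite, Finset.sum_const, Finset.sum_const]
  simp only [nsmul_eq_mul]
  have hB : ((univ.filter fun y : S k => memB 𝓐 (k + 1) (Fin.snoc x y)).card : ℝ) =
      alpha 𝓐 k x * Fintype.card (S k) := by
    rw [alpha, div_mul_cancel₀ _ hc.ne']
  have hN : ((univ.filter fun y : S k => ¬ memB 𝓐 (k + 1) (Fin.snoc x y)).card : ℝ) =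
      (1 - alpha 𝓐 k x) * Fintype.card (S k) := by
    have := Finset.card_filter_add_card_filter_not (s := (univ : Finset (S k)))
      fun y : S k => memB 𝓐 (k + 1) (Fin.snoc x y)
    rw [Finset.card_univ] at this
    have := congrArg (Nat.cast : ℕ → ℝ) this
    push_cast at this
    linarith
  rw [hB, hN]
  have h1' : 1 - δ k ≠ 0 := by linarith
  split_ifs with h
  · have : 1 - alpha 𝓐 k x ≠ 0 := by linarith
    field_simp
    ring
  · have : alpha 𝓐 k x ≠ 0 := by linarith
    field_simp
    ring

theorem sum_w_eq_one (hδ : ∀ j < k, δ j ∈ Set.Ico (0 : ℝ) 1)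
    (hS : ∀ j < k, 0 < Fintype.card (S j)) : ∑ x : Qp S k, w 𝓐 δ k x = 1 := by
  induction k with
  | zero => simp [w]
  | succ k ih =>
    rw [sum_Qp_succ, ← ih (fun j hj => hδ j (by omega)) (fun j hj => hS j (by omega))]
    exact Finset.sum_congr rfl fun x _ => sum_w_snoc 𝓐 δ (hδ k (by omega)) (hS k (by omega)) x

/-- The part of `Q_k` covered by hyperplanes of stage at most `k` has weight at most the sum of
the weights `w_j(B_j)` over `j ≤ k`. -/
theorem sum_w_covered_le (hδ : ∀ j < k, δ j ∈ Set.Ico (0 : ℝ) 1)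
    (hS : ∀ j < k, 0 < Fintype.card (S j)) :
    ∑ x : Qp S k, (if ∃ i, (𝓐 i).stage ≤ k ∧ memH (𝓐 i) x then w 𝓐 δ k x else 0) ≤
      ∑ j ∈ Finset.range k, wB 𝓐 δ (j + 1) := by
  induction k with
  | zero => simp [Hyp.stage]
  | succ k ih =>
    rw [Finset.sum_range_succ]
    refine le_trans ?_ (add_le_add_left
      (ih (fun j hj => hδ j (by omega)) (fun j hj => hS j (by omega))) _)
    have hfiber (x : Qp S k) :
        (if ∃ i, (𝓐 i).stage ≤ k ∧ memH (𝓐 i) x then w 𝓐 δ k x else 0) =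
          ∑ y : S k, if ∃ i, (𝓐 i).stage ≤ k ∧ memH (𝓐 i) x then
            w 𝓐 δ (k + 1) (Fin.snoc x y) else 0 := by
      split_ifs
      · exact (sum_w_snoc 𝓐 δ (hδ k (by omega)) (hS k (by omega)) x).symm
      · simp
    rw [Finset.sum_congr rfl fun x _ => hfiber x, wB, Finset.sum_filter, sum_Qp_succ, sum_Qp_succ,
      ← Finset.sum_add_distrib]
    refine Finset.sum_le_sum fun x _ => ?_
    rw [← Finset.sum_add_distrib]
    refine Finset.sum_le_sum fun y _ => ?_
    have hw : 0 ≤ w 𝓐 δ (k + 1) (Fin.snoc x y) := w_nonneg 𝓐 δ hδ _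
    have hcov : (∃ i, (𝓐 i).stage ≤ k + 1 ∧ memH (𝓐 i) (Fin.snoc x y : Qp S (k + 1))) →
        (∃ i, (𝓐 i).stage ≤ k ∧ memH (𝓐 i) x) ∨
          memB 𝓐 (k + 1) (Fin.snoc x y : Qp S (k + 1)) := by
      rintro ⟨i, hi, hm⟩
      rcases hi.lt_or_eq with h | h
      · refine .inl ⟨i, by omega, fun j hj => ?_⟩
        exact (Fin.snoc_castSucc (α := fun j : Fin (k + 1) => S j) y x j).symm.trans
          (hm j.castSucc hj)
      · exact .inr ⟨i, h, hm⟩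
    split_ifs <;> first | linarith | exact absurd (hcov ‹_›) (not_or.2 ⟨‹_›, ‹_›⟩)

end Lemmas

/-- **Lemma (non-covering criterion).**  If `∑_{k=1}^{n} w_k(B_k) < 1`, then
the collection `𝒜` does not cover `Q = Q_n`: some element of `Q` lies on no
hyperplane of `𝒜`. -/
theorem not_cover_of_sum_wB_lt_one
    (S : ℕ → Type) [∀ j, Fintype (S j)] (n : ℕ) (hn : 0 < n)
    (hcard : ∀ j, j < n → 2 ≤ Fintype.card (S j))
    (δ : ℕ → ℝ) (hδ : ∀ j, j < n → δ j ∈ Set.Icc (0 : ℝ) (1 / 2))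
    (ι : Type) [Fintype ι] (𝓐 : ι → Hyp S n)
    (hFne : ∀ i, (𝓐 i).F.Nonempty)
    (hsum : ∑ k ∈ Finset.range n, wB 𝓐 δ (k + 1) < 1) :
    ∃ x : Qp S n, ∀ i, ¬ memH (𝓐 i) x := by
  have hδ' : ∀ j < n, δ j ∈ Set.Ico (0 : ℝ) 1 := fun j hj =>
    ⟨(hδ j hj).1, by linarith [(hδ j hj).2]⟩
  have hS : ∀ j < n, 0 < Fintype.card (S j) := fun j hj => by linarith [hcard j hj]
  by_contra! hcover
  have hall (x : Qp S n) : ∃ i, (𝓐 i).stage ≤ n ∧ memH (𝓐 i) x := by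
    obtain ⟨i, hi⟩ := hcover x
    exact ⟨i, (Finset.sup_lt_iff hn).2 (𝓐 i).hF, hi⟩
  have h := sum_w_covered_le 𝓐 δ hδ' hS
  simp only [hall, if_true, sum_w_eq_one 𝓐 δ hδ' hS] at h
  linarith
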